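/- Define polynomials p_0(x)=1, p_1(x)=1−x, p_{h+1}(x)=p_h(x) − x·p_{h−1}(x). Then the ordinary generating function Σ_n f_{≤h}^n x^n for the number of nonisomorphic n-element semiorders of length at most h equals p_h(x)/p_{h+1}(x). -/

import Mathlib

namespace Paper

/-- Two elements are incomparable. -/
def Incomp {α : Type*} [PartialOrder α] (a b : α) : Prop := ¬ a ≤ b ∧ ¬ b ≤ a

/-- A semiorder: no induced `2+2` and no induced `3+1`. -/
def IsSemiorder (α : Type*) [PartialOrder α] : Prop :=
  (¬ ∃ x y z w : α, y < x ∧ w < z ∧ Incomp x z ∧ Incomp x w ∧ Incomp y z ∧ Incomp y w) ∧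
  (¬ ∃ x y z w : α, z < y ∧ y < x ∧ Incomp x w ∧ Incomp y w ∧ Incomp z w)

/-- There is a chain of `k` elements. -/
def HasChain (α : Type*) [Preorder α] (k : ℕ) : Prop := ∃ c : Fin k → α, StrictMono c

/-- The length of a longest chain (number of edges) is exactly `H`. -/
def HasLength (α : Type*) [Preorder α] (H : ℕ) : Prop :=
  HasChain α (H + 1) ∧ ¬ HasChain α (H + 2)

/-- There is a chain of `k` elements all strictly above `a`. -/
def HasChainAbove {α : Type*} [Preorder α] (a : α) (k : ℕ) : Prop :=
  ∃ c : Fin k → α, StrictMono c ∧ ∀ j, a < c j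

/-- `a` is on the `i`-th level (`i ≥ 1`). -/
def OnLevel {α : Type*} [Preorder α] (a : α) (i : ℕ) : Prop :=
  1 ≤ i ∧ HasChainAbove a (i - 1) ∧ ¬ HasChainAbove a i

/-- Number of isomorphism classes of partial orders on `Fin n` satisfying `pred`. -/
noncomputable def countPosets (n : ℕ) (pred : PartialOrder (Fin n) → Prop) : ℕ :=
  Nat.card (Quot (fun (P Q : {P : PartialOrder (Fin n) // pred P}) =>
    ∃ e : Fin n ≃ Fin n, ∀ a b : Fin n,
      (@LE.le _ P.1.toPreorder.toLE a b ↔ @LE.le _ Q.1.toPreorder.toLE (e a) (e b))))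

/-- Semiorder of length exactly `H`. -/
def SemiLen (n H : ℕ) (P : PartialOrder (Fin n)) : Prop :=
  @IsSemiorder (Fin n) P ∧ @HasLength (Fin n) P.toPreorder H

/-- Semiorder of length at most `h`. -/
def SemiLenLe (n h : ℕ) (P : PartialOrder (Fin n)) : Prop :=
  @IsSemiorder (Fin n) P ∧ ¬ @HasChain (Fin n) P.toPreorder (h + 2)

/-- `f_H^n`. -/
noncomputable def fEx (H n : ℕ) : ℕ := countPosets n (SemiLen n H)

/-- `f_{≤h}^n`. -/
noncomputable def fLe (h n : ℕ) : ℕ := countPosets n (SemiLenLe n h)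

/-- Ordered (plane) trees. -/
inductive PTree where
  | node : List PTree → PTree

def PTree.size : PTree → ℕ
  | .node cs => 1 + (cs.attach.map fun c => PTree.size c.1).sum
decreasing_by have := List.sizeOf_lt_of_mem c.2; simp only [PTree.node.sizeOf_spec] at *; omega

def PTree.height : PTree → ℕ
  | .node cs => (cs.attach.map fun c => PTree.height c.1 + 1).foldr max 0
decreasing_by have := List.sizeOf_lt_of_mem c.2; simp only [PTree.node.sizeOf_spec] at *; omega

def PTree.countDepth : PTree → ℕ → ℕ
  | .node _, 0 => 1
  | .node cs, d + 1 => (cs.attach.map fun c => PTree.countDepth c.1 d).sum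
termination_by t _ => sizeOf t
decreasing_by have := List.sizeOf_lt_of_mem c.2; simp only [PTree.node.sizeOf_spec] at *; omega

/-- Value of a path after the steps in `l` (`true` = up-step, `false` = down-step). -/
def pathVal (l : List Bool) : ℤ := (l.map fun b => if b then (1 : ℤ) else -1).sum

/-- `l` is a Dyck path. -/
def IsDyckPath (l : List Bool) : Prop :=
  pathVal l = 0 ∧ ∀ p, p <+: l → 0 ≤ pathVal p

/-- The height of the path `l` is exactly `H`. -/
def DyckHeightIs (l : List Bool) (H : ℕ) : Prop :=
  (∃ p, p <+: l ∧ pathVal p = H) ∧ ∀ p, p <+: l → pathVal p ≤ (H : ℤ)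

/-- Number of peaks of a path. -/
def peaks (l : List Bool) : ℕ :=
  ((List.range l.length).filter fun i => l.getD i false && !(l.getD (i + 1) true)).length


/-- The polynomials `p_0 = 1`, `p_1 = 1 - x`, `p_{h+1} = p_h - x p_{h-1}`,
viewed as formal power series over `ℚ`. -/
noncomputable def pSeq : ℕ → PowerSeries ℚ
  | 0 => 1
  | 1 => 1 - PowerSeries.X
  | (h + 2) => pSeq (h + 1) - PowerSeries.X * pSeq h

/-- The power series `U_0 = 0`, `U_{k+1} = x / (1 - U_k)`, which count plane trees by height. -/
noncomputable def treeSeries : ℕ → PowerSeries ℚ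
  | 0 => 0
  | k + 1 => PowerSeries.X * (1 - treeSeries k)⁻¹

open PowerSeries in
lemma constantCoeff_treeSeries (k : ℕ) : constantCoeff (treeSeries k) = 0 := by
  cases k <;> simp [treeSeries]

open PowerSeries in
lemma one_sub_treeSeries_mul_inv (k : ℕ) : (1 - treeSeries k) * (1 - treeSeries k)⁻¹ = 1 :=
  PowerSeries.mul_inv_cancel _ (by simp [constantCoeff_treeSeries])

open PowerSeries in
lemma treeSeries_succ_mul_pSeq (h : ℕ) :
    treeSeries (h + 2) * pSeq (h + 1) = X * pSeq h := by
  induction h with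
  | zero =>
    have := one_sub_treeSeries_mul_inv 1
    simp only [treeSeries, pSeq, sub_zero, inv_one, mul_one] at this ⊢
    linear_combination (X : PowerSeries ℚ) * this
  | succ h ih =>
    have := one_sub_treeSeries_mul_inv (h + 2)
    rw [treeSeries, pSeq, ← ih]
    linear_combination (X : PowerSeries ℚ) * pSeq (h + 1) * this

open PowerSeries in
lemma constantCoeff_pSeq (h : ℕ) : constantCoeff (pSeq h) = 1 := by
  induction h using Nat.twoStepInduction with
  | zero => simp [pSeq]
  | one => simp [pSeq]
  | more h _ ih => simp [pSeq, ih]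

open PowerSeries in
lemma inv_one_sub_treeSeries_eq (h : ℕ) :
    (1 - treeSeries (h + 1))⁻¹ = pSeq h * (pSeq (h + 1))⁻¹ := by
  rw [PowerSeries.eq_mul_inv_iff_mul_eq (by simp [constantCoeff_pSeq])]
  have := treeSeries_succ_mul_pSeq h
  rw [treeSeries, mul_assoc] at this
  exact X_mul_cancel this

open PowerSeries in
lemma coeff_inv_one_sub_mul {u : PowerSeries ℚ} (hu : constantCoeff u = 0) (v : PowerSeries ℚ)
    (n : ℕ) :
    coeff n ((1 - u)⁻¹ * v) = ∑ d ∈ Finset.range (n + 1), coeff n (u ^ d * v) := by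
  have hinv : (1 - u) * (1 - u)⁻¹ = 1 := PowerSeries.mul_inv_cancel _ (by simp [hu])
  have hgeom := geom_sum_mul_neg u (n + 1)
  have key : (1 - u)⁻¹ * v =
      (∑ d ∈ Finset.range (n + 1), u ^ d) * v + u ^ (n + 1) * ((1 - u)⁻¹ * v) := by
    linear_combination (∑ d ∈ Finset.range (n + 1), u ^ d) * v * hinv - (1 - u)⁻¹ * v * hgeom
  have hdvd : (X : PowerSeries ℚ) ^ (n + 1) ∣ u ^ (n + 1) * ((1 - u)⁻¹ * v) :=
    (pow_dvd_pow_of_dvd (X_dvd_iff.mpr hu) _).mul_right _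
  rw [key, map_add, X_pow_dvd_iff.mp hdvd n n.lt_succ_self, add_zero, Finset.sum_mul, map_sum]

/-- Breadth-first codes (lists of child counts) of plane forests with `n` unprocessed nodes, of
which `r` remain on the current level and `b` have been found on the next one, with at most `k`
levels after the current one. -/
def forestCodes : ℕ → ℕ → ℕ → ℕ → Finset (List ℕ)
  | 0, _, r, b => if r = 0 ∧ b = 0 then {[]} else ∅
  | n + 1, k, r + 1, b =>
    (Finset.range (n + 1)).biUnion fun d => (forestCodes n k r (b + d)).image (List.cons d)
  | n + 1, k + 1, 0, b + 1 =>
    (Finset.range (n + 1)).biUnion fun d => (forestCodes n k b d).image (List.cons d)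
  | _ + 1, 0, 0, _ => ∅
  | _ + 1, _ + 1, 0, 0 => ∅

lemma card_biUnion_image_cons (s : Finset ℕ) (t : ℕ → Finset (List ℕ)) :
    (s.biUnion fun d => (t d).image (List.cons d)).card = ∑ d ∈ s, (t d).card := by
  rw [Finset.card_biUnion]
  · exact Finset.sum_congr rfl fun d _ =>
      Finset.card_image_of_injective _ fun _ _ h => (List.cons.inj h).2
  · intro a _ b _ hab
    simp only [Finset.disjoint_left, Finset.mem_image]
    rintro _ ⟨l, _, rfl⟩ ⟨l', _, h⟩
    exact hab (List.cons.inj h).1.symm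

open PowerSeries in
lemma card_forestCodes (n k r b : ℕ) :
    ((forestCodes n k r b).card : ℚ) =
      coeff n (treeSeries (k + 1) ^ r * treeSeries k ^ b) := by
  induction n generalizing k r b with
  | zero =>
    by_cases hr : r = 0 <;> by_cases hb : b = 0 <;>
      simp [forestCodes, hr, hb, constantCoeff_treeSeries]
  | succ n ih =>
    have step (k : ℕ) (v : PowerSeries ℚ) : coeff (n + 1) (treeSeries (k + 1) * v) =
        ∑ d ∈ Finset.range (n + 1), coeff n (treeSeries k ^ d * v) := by
      rw [treeSeries, mul_assoc, coeff_succ_X_mul,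
        coeff_inv_one_sub_mul (constantCoeff_treeSeries k)]
    match k, r, b with
    | k, r + 1, b =>
      rw [forestCodes, card_biUnion_image_cons, pow_succ', mul_assoc, step, Nat.cast_sum]
      refine Finset.sum_congr rfl fun d _ => ?_
      rw [ih]
      congr 1
      ring
    | k + 1, 0, b + 1 =>
      rw [forestCodes, card_biUnion_image_cons, pow_zero, one_mul, pow_succ', step, Nat.cast_sum]
      refine Finset.sum_congr rfl fun d _ => ?_
      rw [ih, mul_comm]
    | 0, 0, 0 => simp [forestCodes, coeff_one]
    | 0, 0, b + 1 => simp [forestCodes, treeSeries]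
    | k + 1, 0, 0 => simp [forestCodes, coeff_one]

lemma mem_forestCodes (n k r b : ℕ) (l : List ℕ) :
    l ∈ forestCodes n k r b ↔ l.length = n ∧ (∀ j < n, j < r + b + (l.take j).sum) ∧
      r + b + l.sum = n ∧ n ≤ (fun j => r + b + (l.take j).sum)^[k] r := by
  have iter (q q' d k r : ℕ) (l : List ℕ) (hq : q + d = q' + 1) :
      (fun j => q + ((d :: l).take j).sum)^[k] (r + 1) =
        (fun j => q' + (l.take j).sum)^[k] r + 1 := by
    have hs : Function.Semiconj (· + 1) (fun j => q' + (l.take j).sum)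
        (fun j => q + ((d :: l).take j).sum) := fun j => by
      simp only [List.take_succ_cons, List.sum_cons]
      lia
    exact (hs.iterate_right k r).symm
  have cons_cond (q q' d n : ℕ) (l : List ℕ) (hq : q + d = q' + 1) :
      (∀ j < n + 1, j < q + ((d :: l).take j).sum) ↔
        0 < q ∧ ∀ j < n, j < q' + (l.take j).sum := by
    constructor
    · refine fun h => ⟨by simpa using h 0 (by lia), fun j hj => ?_⟩
      have := h (j + 1) (by lia)
      simp only [List.take_succ_cons, List.sum_cons] at this
      lia
    · rintro ⟨h0, h⟩ (_ | j) hj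
      · simpa using h0
      · have := h j (by lia)
        simp only [List.take_succ_cons, List.sum_cons]
        lia
  induction n generalizing k r b l with
  | zero =>
    cases l with
    | nil => by_cases hr : r = 0 <;> by_cases hb : b = 0 <;> simp [forestCodes, hr, hb]
    | cons d l => simp only [forestCodes]; split_ifs <;> simp
  | succ n ih =>
    match k, r, b with
    | k, r + 1, b =>
      simp only [forestCodes, Finset.mem_biUnion, Finset.mem_range, Finset.mem_image, ih]
      constructor
      · rintro ⟨d, hd, l, ⟨hl, hpos, hsum, hk⟩, rfl⟩
        refine ⟨by simp [hl], ?_, by simp only [List.sum_cons]; lia, ?_⟩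
        · exact (cons_cond _ (r + (b + d)) d n l (by lia)).mpr ⟨by lia, hpos⟩
        · rw [iter _ (r + (b + d)) d k r l (by lia)]
          lia
      · rintro ⟨hl, hpos, hsum, hk⟩
        obtain _ | ⟨d, l⟩ := l
        · simp at hl
        simp only [List.sum_cons, List.length_cons] at hsum hl
        rw [iter _ (r + (b + d)) d k r l (by lia)] at hk
        exact ⟨d, by lia, l, ⟨by lia,
          ((cons_cond _ (r + (b + d)) d n l (by lia)).mp hpos).2, by lia, by lia⟩, rfl⟩
    | k + 1, 0, b + 1 =>
      simp only [forestCodes, Finset.mem_biUnion, Finset.mem_range, Finset.mem_image, ih,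
        Function.iterate_succ_apply, List.take_zero, List.sum_nil, add_zero, zero_add]
      constructor
      · rintro ⟨d, hd, l, ⟨hl, hpos, hsum, hk⟩, rfl⟩
        refine ⟨by simp [hl], ?_, by simp only [List.sum_cons]; lia, ?_⟩
        · exact (cons_cond _ (b + d) d n l (by lia)).mpr ⟨by lia, hpos⟩
        · rw [iter _ (b + d) d k b l (by lia)]
          lia
      · rintro ⟨hl, hpos, hsum, hk⟩
        obtain _ | ⟨d, l⟩ := l
        · simp at hl
        simp only [List.sum_cons, List.length_cons] at hsum hl
        rw [iter _ (b + d) d k b l (by lia)] at hk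
        exact ⟨d, by lia, l, ⟨by lia,
          ((cons_cond _ (b + d) d n l (by lia)).mp hpos).2, by lia, by lia⟩, rfl⟩
    | 0, 0, b => simp [forestCodes]
    | k + 1, 0, 0 =>
      simp only [forestCodes, Finset.notMem_empty, false_iff]
      rintro ⟨-, hpos, -⟩
      simpa using hpos 0 (by lia)

/-- The `a`-th threshold of a code: the poset it encodes has `a < b` iff `threshold l a ≤ b`. -/
def threshold (l : List ℕ) (j : ℕ) : ℕ := (l.take (j + 1)).sum

lemma monotone_sum_take (l : List ℕ) : Monotone fun j => (l.take j).sum :=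
  fun _ _ h => (List.take_sublist_take_left h).sum_le_sum fun _ _ => Nat.zero_le _

lemma monotone_threshold (l : List ℕ) : Monotone (threshold l) :=
  fun _ _ h => monotone_sum_take l (Nat.succ_le_succ h)

lemma mem_forestCodes_one_zero (n h : ℕ) (l : List ℕ) :
    l ∈ forestCodes (n + 1) (h + 1) 1 0 ↔ l.length = n + 1 ∧ (∀ j < n, j < threshold l j) ∧
      l.sum = n ∧ n ≤ (threshold l)^[h + 1] 0 := by
  have hs : Function.Semiconj (· + 1) (threshold l) (fun j => 1 + 0 + (l.take j).sum) := fun j => by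
    simp only [threshold]
    lia
  have hiter := (hs.iterate_right (h + 1) 0).symm
  rw [mem_forestCodes]
  refine and_congr_right fun _ => and_congr ⟨fun H j hj => ?_, ?_⟩ (and_congr (by lia) ?_)
  · have := H (j + 1) (by lia)
    simp only [threshold]
    lia
  · rintro H (_ | j) hj
    · lia
    · have := H j (by lia)
      simp only [threshold] at this
      lia
  · simp only [zero_add] at hiter
    rw [hiter]
    lia

/-- The poset on `Fin n` with `a < b` iff `g a ≤ b`. -/
@[reducible]
def thresholdOrder (n : ℕ) (g : ℕ → ℕ) (hg : ∀ j < n, j < g j) : PartialOrder (Fin n) where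
  le a b := a = b ∨ g a ≤ b
  lt a b := g a ≤ b
  le_refl a := Or.inl rfl
  le_trans a b c := by
    rintro (rfl | h) (rfl | h')
    · exact Or.inl rfl
    · exact Or.inr h'
    · exact Or.inr h
    · exact Or.inr (h.trans ((hg b b.2).le.trans h'))
  lt_iff_le_not_ge a b := by
    have := hg a a.2
    have := hg b b.2
    rw [Fin.ext_iff, Fin.ext_iff]
    lia
  le_antisymm a b := by
    have := hg a a.2
    have := hg b b.2
    simp only [Fin.ext_iff]
    lia

section thresholdOrder

variable {n : ℕ} {g : ℕ → ℕ} (hg : ∀ j < n, j < g j)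

lemma isSemiorder_thresholdOrder (hmono : Monotone g) :
    @IsSemiorder (Fin n) (thresholdOrder n g hg) := by
  constructor
  · rintro ⟨x, y, z, w, hyx, hwz, -, ⟨-, hwx⟩, ⟨hyz, -⟩, -⟩
    change g y ≤ x at hyx
    change g w ≤ z at hwz
    change ¬ (_ = _ ∨ g w ≤ x) at hwx
    change ¬ (_ = _ ∨ g y ≤ z) at hyz
    rcases le_total (y : ℕ) w with h | h
    · exact hyz (Or.inr ((hmono h).trans hwz))
    · exact hwx (Or.inr ((hmono h).trans hyx))
  · rintro ⟨x, y, z, w, hzy, hyx, ⟨-, hwx⟩, -, ⟨hzw, -⟩⟩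
    change g z ≤ y at hzy
    change g y ≤ x at hyx
    change ¬ (_ = _ ∨ g w ≤ x) at hwx
    change ¬ (_ = _ ∨ g z ≤ w) at hzw
    rcases le_total (w : ℕ) y with h | h
    · exact hwx (Or.inr ((hmono h).trans hyx))
    · exact hzw (Or.inr (hzy.trans h))

lemma hasChain_thresholdOrder (hmono : Monotone g) (hn : ∀ j, n ≤ j → n ≤ g j) (k : ℕ) :
    @HasChain (Fin n) (thresholdOrder n g hg).toPreorder (k + 1) ↔ g^[k] 0 < n := by
  let := thresholdOrder n g hg
  constructor
  · rintro ⟨c, hc⟩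
    have key (i : ℕ) (hi : i < k + 1) : g^[i] 0 ≤ c ⟨i, hi⟩ := by
      induction i with
      | zero => exact Nat.zero_le _
      | succ i ih =>
        rw [Function.iterate_succ_apply']
        have hlt : g (c ⟨i, by lia⟩) ≤ c ⟨i + 1, hi⟩ :=
          hc (show (⟨i, by lia⟩ : Fin (k + 1)) < ⟨i + 1, hi⟩ from Nat.lt_succ_self i)
        exact (hmono (ih _)).trans hlt
    exact (key k (by lia)).trans_lt (c _).2
  · intro hk
    have key (i : ℕ) (hi : i ≤ k) : g^[i] 0 < n := by
      induction hi using Nat.decreasingInduction with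
      | self => exact hk
      | of_succ i _ ih =>
        rw [Function.iterate_succ_apply'] at ih
        exact lt_of_not_ge fun h => absurd (hn _ h) (by lia)
    refine ⟨fun i => ⟨g^[i] 0, key i (by lia)⟩, Fin.strictMono_iff_lt_succ.mpr fun i => ?_⟩
    change g (g^[i] 0) ≤ g^[i + 1] 0
    rw [Function.iterate_succ_apply']

end thresholdOrder

lemma eq_of_thresholdOrder_iso {n : ℕ} {g g' : ℕ → ℕ} (hmono : Monotone g) (hmono' : Monotone g')
    (hle : ∀ j < n, g j ≤ n) (hle' : ∀ j < n, g' j ≤ n)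
    (e : Fin n ≃ Fin n) (he : ∀ a b : Fin n, g a ≤ b ↔ g' (e a) ≤ e b) {j : ℕ} (hj : j < n) :
    g j = g' j := by
  have hcard (m : ℕ) (hm : m ≤ n) : (Finset.univ.filter fun b : Fin n => m ≤ b).card = n - m := by
    have hsum := Finset.card_filter_add_card_filter_not
      (s := (Finset.univ : Finset (Fin n))) fun b : Fin n => (b : ℕ) < m
    simp only [Fin.card_filter_val_lt, not_lt, Finset.card_univ, Fintype.card_fin] at hsum
    lia
  have hcomp (a : Fin n) : g a = g' (e a) := by
    have h := Finset.card_equiv (s := Finset.univ.filter fun b : Fin n => g a ≤ b)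
      (t := Finset.univ.filter fun b : Fin n => g' (e a) ≤ b) e (by simp [he])
    rw [hcard _ (hle _ a.2), hcard _ (hle' _ (e a).2)] at h
    have := hle _ a.2
    have := hle' _ (e a).2
    lia
  have hsort := Tuple.unique_monotone (f := fun a : Fin n => g' a) (σ := e) (τ := Equiv.refl _)
    (fun a b hab => by
      simp only [Function.comp, ← hcomp]
      exact hmono hab)
    (fun a b hab => hmono' hab)
  have := congrFun hsort ⟨j, hj⟩
  simp only [Function.comp, ← hcomp] at this
  exact this

lemma list_eq_of_sum_take_eq {l l' : List ℕ} (hlen : l.length = l'.length)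
    (h : ∀ j ≤ l.length, (l.take j).sum = (l'.take j).sum) : l = l' := by
  refine List.ext_getElem hlen fun i hi hi' => ?_
  have h1 := h i hi.le
  have h2 := h (i + 1) hi
  rw [List.sum_take_succ _ _ hi, List.sum_take_succ _ _ hi'] at h2
  lia

lemma exists_list_sum_take_eq (f : ℕ → ℕ) (hf : Monotone f) (h0 : f 0 = 0) (m : ℕ) :
    ∃ l : List ℕ, l.length = m ∧ ∀ j ≤ m, (l.take j).sum = f j := by
  refine ⟨(List.range m).map fun j => f (j + 1) - f j, by simp, fun j hj => ?_⟩
  rw [← List.map_take, List.take_range, min_eq_left hj]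
  clear hj
  induction j with
  | zero => simp [h0]
  | succ j ih =>
    rw [List.sum_range_succ, ih]
    have := hf (Nat.le_succ j)
    lia

section semiorder

variable {α : Type*} [PartialOrder α]

lemma IsSemiorder.lt_imp_total (hα : IsSemiorder α) (a b : α) :
    (∀ x, x < a → x < b) ∨ (∀ x, x < b → x < a) := by
  by_contra! H
  obtain ⟨⟨x, hxa, hxb⟩, y, hyb, hya⟩ := H
  refine hα.1 ⟨a, x, b, y, hxa, hyb, ⟨fun h => ?_, fun h => ?_⟩, ⟨fun h => ?_, fun h => ?_⟩,
    ⟨fun h => ?_, fun h => ?_⟩, fun h => ?_, fun h => ?_⟩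
  · exact hxb (hxa.trans_le h)
  · exact hya (hyb.trans_le h)
  · exact hxb ((hxa.trans_le h).trans hyb)
  · exact hya (lt_of_le_of_ne h fun h' => hxb (hxa.trans (h' ▸ hyb)))
  · exact hxb (lt_of_le_of_ne h fun h' => hya (hyb.trans (h' ▸ hxa)))
  · exact hya ((hyb.trans_le h).trans hxa)
  · exact hxb (h.trans_lt hyb)
  · exact hya (h.trans_lt hxa)

lemma IsSemiorder.gt_imp_total (hα : IsSemiorder α) (a b : α) :
    (∀ x, a < x → b < x) ∨ (∀ x, b < x → a < x) := by
  by_contra! H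
  obtain ⟨⟨x, hxa, hxb⟩, y, hyb, hya⟩ := H
  rcases hα.lt_imp_total x y with h | h
  · exact hya (h a hxa)
  · exact hxb (h b hyb)

lemma IsSemiorder.lt_imp_or_gt_imp (hα : IsSemiorder α) (a b : α) :
    (∀ x, x < a → x < b) ∨ (∀ x, a < x → b < x) := by
  by_contra! H
  obtain ⟨⟨x, hxa, hxb⟩, y, hay, hby⟩ := H
  refine hα.2 ⟨y, a, x, b, hxa, hay, ⟨fun h => ?_, fun h => ?_⟩, ⟨fun h => ?_, fun h => ?_⟩,
    fun h => ?_, fun h => ?_⟩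
  · exact hxb ((hxa.trans hay).trans_le h)
  · exact hby (lt_of_le_of_ne h fun h' => hxb (h' ▸ hxa.trans hay))
  · exact hxb (hxa.trans_le h)
  · exact hby (h.trans_lt hay)
  · exact hxb (lt_of_le_of_ne h fun h' => hby (h' ▸ hxa.trans hay))
  · exact hby (h.trans_lt (hxa.trans hay))

lemma IsSemiorder.exists_key [Fintype α] (hα : IsSemiorder α) :
    ∃ key : α → ℤ, ∀ a b, key a ≤ key b →
      (∀ x, x < a → x < b) ∧ (∀ x, b < x → a < x) := by
  classical
  let D (a : α) : Finset α := Finset.univ.filter (· < a)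
  let U (a : α) : Finset α := Finset.univ.filter (a < ·)
  have card_D {a b : α} (h : ∀ x, x < a → x < b) : (D a).card ≤ (D b).card :=
    Finset.card_le_card fun x => by simpa [D] using h x
  have card_U {a b : α} (h : ∀ x, a < x → b < x) : (U a).card ≤ (U b).card :=
    Finset.card_le_card fun x => by simpa [U] using h x
  have card_D_lt {a b : α} (h : ∀ x, x < b → x < a) (h' : ¬ ∀ x, x < a → x < b) :
      (D b).card < (D a).card := by
    refine Finset.card_lt_card (Finset.ssubset_iff_subset_ne.mpr ⟨fun x => ?_, fun he => h' ?_⟩)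
    · simpa [D] using h x
    · exact fun x hx => by simpa [D] using he.ge (by simpa [D] using hx : x ∈ D a)
  have card_U_lt {a b : α} (h : ∀ x, b < x → a < x) (h' : ¬ ∀ x, a < x → b < x) :
      (U b).card < (U a).card := by
    refine Finset.card_lt_card (Finset.ssubset_iff_subset_ne.mpr ⟨fun x => ?_, fun he => h' ?_⟩)
    · simpa [U] using h x
    · exact fun x hx => by simpa [U] using he.ge (by simpa [U] using hx : x ∈ U a)
  refine ⟨fun a => (D a).card - (U a).card, fun a b hab => ⟨?_, ?_⟩⟩
  · by_contra H
    have h1 := card_D_lt ((hα.lt_imp_total a b).resolve_left H) H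
    have h2 := card_U ((hα.lt_imp_or_gt_imp a b).resolve_left H)
    lia
  · by_contra H
    have h1 := card_U_lt ((hα.gt_imp_total a b).resolve_right H) H
    have h2 := card_D ((hα.lt_imp_or_gt_imp b a).resolve_right H)
    lia

end semiorder

lemma IsSemiorder.exists_threshold {n : ℕ} {α : Type*} [PartialOrder α] (hα : IsSemiorder α)
    (e₀ : Fin n ≃ α) :
    ∃ (e : Fin n ≃ α) (g : ℕ → ℕ), Monotone g ∧ (∀ j < n, j < g j) ∧ (∀ j, g j ≤ n) ∧
      g n = n ∧ ∀ a b : Fin n, g a ≤ b ↔ e a < e b := by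
  classical
  let := Fintype.ofEquiv _ e₀
  obtain ⟨key, hkey⟩ := hα.exists_key
  let e : Fin n ≃ α := (Tuple.sort (key ∘ e₀)).trans e₀
  have he (a b : Fin n) (h : (a : ℕ) ≤ b) :
      (∀ x, x < e a → x < e b) ∧ (∀ x, e b < x → e a < x) :=
    hkey _ _ (Tuple.monotone_sort (key ∘ e₀) h)
  let S (a : Fin n) : Finset (Fin n) := Finset.univ.filter fun b => ¬ e a < e b
  have mem_S (a b : Fin n) : b ∈ S a ↔ ¬ e a < e b := by simp [S]
  have card_S (a : Fin n) : (S a).card ≤ n := card_finset_fin_le _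
  have lt_card_S (a b : Fin n) : (b : ℕ) < (S a).card ↔ ¬ e a < e b := by
    rw [← mem_S]
    constructor
    · intro h
      by_contra hb
      refine h.not_ge ((Finset.card_le_card (t := Finset.univ.filter fun c : Fin n => (c : ℕ) < b)
        fun c hc => ?_).trans (Fin.card_filter_val_lt.trans_le (min_le_right _ _)))
      simp only [Finset.mem_filter, Finset.mem_univ, true_and]
      rw [mem_S] at hb hc
      exact lt_of_not_ge fun hbc => hc ((he b c hbc).1 _ (not_not.mp hb))
    · intro h
      have hsub : (Finset.univ.filter fun c : Fin n => (c : ℕ) < b + 1) ⊆ S a := fun c hc => by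
        simp only [Finset.mem_filter, Finset.mem_univ, true_and] at hc
        rw [mem_S] at h ⊢
        exact fun hac => h ((he c b (by lia)).1 _ hac)
      have := Finset.card_le_card hsub
      rw [Fin.card_filter_val_lt] at this
      lia
  have hg {j : ℕ} (hj : j < n) : (if h : j < n then (S ⟨j, h⟩).card else n) = (S ⟨j, hj⟩).card :=
    dif_pos hj
  refine ⟨e, fun j => if h : j < n then (S ⟨j, h⟩).card else n, fun i j hij => ?_,
    fun j hj => ?_, fun j => ?_, by simp, fun a b => ?_⟩
  · by_cases hj : j < n
    · simp only [hg hj, hg (hij.trans_lt hj)]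
      refine Finset.card_le_card fun c hc => ?_
      rw [mem_S] at hc ⊢
      exact fun h => hc ((he ⟨i, hij.trans_lt hj⟩ ⟨j, hj⟩ hij).2 _ h)
    · simp only [dif_neg hj]
      split_ifs <;> simp [card_S]
  · simp only [hg hj]
    exact (lt_card_S ⟨j, hj⟩ ⟨j, hj⟩).mpr (lt_irrefl _)
  · dsimp only
    split_ifs <;> simp [card_S]
  · simp only [hg a.2]
    exact not_lt.symm.trans ((not_congr (lt_card_S a b)).trans not_not)

lemma HasChain.of_orderIso {α β : Type*} [PartialOrder α] [PartialOrder β] {k : ℕ}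
    (e : α ≃o β) (h : HasChain α k) : HasChain β k :=
  let ⟨c, hc⟩ := h
  ⟨e ∘ c, e.strictMono.comp hc⟩

lemma threshold_eq_of_le {n : ℕ} {l : List ℕ} (hlen : l.length = n + 1) (hsum : l.sum = n) {j : ℕ}
    (hj : n ≤ j) : threshold l j = n := by
  rw [threshold, List.take_of_length_le (by lia), hsum]

lemma threshold_le {n : ℕ} {l : List ℕ} (hlen : l.length = n + 1) (hsum : l.sum = n) (j : ℕ) :
    threshold l j ≤ n := by
  rcases le_total n j with h | h
  · exact (threshold_eq_of_le hlen hsum h).le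
  · exact (monotone_threshold l h).trans (threshold_eq_of_le hlen hsum le_rfl).le

lemma equivalence_iso {n : ℕ} (p : PartialOrder (Fin n) → Prop) :
    Equivalence fun P Q : {P : PartialOrder (Fin n) // p P} =>
      ∃ e : Fin n ≃ Fin n, ∀ a b : Fin n,
        (@LE.le _ P.1.toPreorder.toLE a b ↔ @LE.le _ Q.1.toPreorder.toLE (e a) (e b)) where
  refl _ := ⟨Equiv.refl _, fun _ _ => Iff.rfl⟩
  symm := fun ⟨e, he⟩ => ⟨e.symm, fun a b => by simp [he]⟩
  trans := fun ⟨e, he⟩ ⟨e', he'⟩ => ⟨e.trans e', fun a b => (he a b).trans (he' _ _)⟩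

lemma semiLenLe_thresholdOrder {n h : ℕ} {l : List ℕ} (hlen : l.length = n + 1)
    (hpos : ∀ j < n, j < threshold l j) (hsum : l.sum = n) (hh : n ≤ (threshold l)^[h + 1] 0) :
    SemiLenLe n h (thresholdOrder n (threshold l) hpos) := by
  refine ⟨isSemiorder_thresholdOrder hpos (monotone_threshold l), ?_⟩
  rw [hasChain_thresholdOrder hpos (monotone_threshold l)
    fun _ hj => (threshold_eq_of_le hlen hsum hj).ge]
  exact not_lt.mpr hh

lemma eq_of_threshold_iso {n : ℕ} {l l' : List ℕ} (hlen : l.length = n + 1)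
    (hsum : l.sum = n) (hlen' : l'.length = n + 1) (hsum' : l'.sum = n)
    (e : Fin n ≃ Fin n)
    (he : ∀ a b : Fin n, threshold l a ≤ b ↔ threshold l' (e a) ≤ e b) : l = l' := by
  refine list_eq_of_sum_take_eq (hlen.trans hlen'.symm) fun j hj => ?_
  obtain _ | j := j
  · simp
  obtain hj' | rfl : j < n ∨ j = n := by lia
  · exact eq_of_thresholdOrder_iso (monotone_threshold l) (monotone_threshold l')
      (fun j _ => threshold_le hlen hsum j) (fun j _ => threshold_le hlen' hsum' j) e he hj'
  · exact (threshold_eq_of_le hlen hsum le_rfl).trans (threshold_eq_of_le hlen' hsum' le_rfl).symm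

lemma exists_code {n h : ℕ} {P : PartialOrder (Fin n)} (hP : SemiLenLe n h P) :
    ∃ (l : List ℕ) (hpos : ∀ j < n, j < threshold l j), l ∈ forestCodes (n + 1) (h + 1) 1 0 ∧
      Nonempty (@OrderIso (Fin n) (Fin n) (thresholdOrder n (threshold l) hpos).toPreorder.toLE
        P.toPreorder.toLE) := by
  obtain ⟨e, g, hmono, hpos, hle, hn, he⟩ :=
    @IsSemiorder.exists_threshold n (Fin n) P hP.1 (Equiv.refl _)
  obtain ⟨l, hlen, hl⟩ := exists_list_sum_take_eq (fun j => Nat.casesOn j 0 g)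
    (monotone_nat_of_le_succ fun j => by
      cases j with
      | zero => exact Nat.zero_le _
      | succ j => exact hmono j.le_succ) rfl (n + 1)
  have hthr (j : ℕ) (hj : j ≤ n) : threshold l j = g j := hl (j + 1) (by lia)
  have hsum : l.sum = n := by
    rw [← hn, ← hthr n le_rfl, threshold, List.take_of_length_le hlen.le]
  have hpos' : ∀ j < n, j < threshold l j := fun j hj => hthr j hj.le ▸ hpos j hj
  let iso : @OrderIso (Fin n) (Fin n) (thresholdOrder n (threshold l) hpos').toPreorder.toLE
      P.toPreorder.toLE :=
    { e with
      map_rel_iff' := fun {a b} => by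
        change @LE.le _ P.toPreorder.toLE (e a) (e b) ↔ a = b ∨ threshold l a ≤ b
        rw [hthr a a.2.le, he, @le_iff_eq_or_lt _ P, e.apply_eq_iff_eq] }
  refine ⟨l, hpos', (mem_forestCodes_one_zero n h l).mpr ⟨hlen, hpos', hsum, ?_⟩, ⟨iso⟩⟩
  by_contra hlt
  exact hP.2 (@HasChain.of_orderIso _ _ (thresholdOrder n (threshold l) hpos') P _ iso
    ((hasChain_thresholdOrder hpos' (monotone_threshold l)
      (fun _ hj => (threshold_eq_of_le hlen hsum hj).ge) (h + 1)).mpr (not_le.mp hlt)))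

lemma fLe_eq_card (h n : ℕ) : fLe h n = (forestCodes (n + 1) (h + 1) 1 0).card := by
  rw [← Nat.card_eq_finsetCard, fLe, countPosets]
  have code (l : forestCodes (n + 1) (h + 1) 1 0) := (mem_forestCodes_one_zero n h l).mp l.2
  symm
  refine Nat.card_eq_of_bijective (fun l => Quot.mk _ ⟨thresholdOrder n (threshold l) (code l).2.1,
    semiLenLe_thresholdOrder (code l).1 (code l).2.1 (code l).2.2.1 (code l).2.2.2⟩) ⟨?_, ?_⟩
  · intro l l' hll
    obtain ⟨e, he⟩ := (equivalence_iso _).eqvGen_iff.mp (Quot.eqvGen_exact hll)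
    refine Subtype.ext (eq_of_threshold_iso (code l).1 (code l).2.2.1 (code l').1
      (code l').2.2.1 e fun a b => ?_)
    have hlt := (@OrderIso.lt_iff_lt _ _
      (thresholdOrder n (threshold l) (code l).2.1).toPreorder
      (thresholdOrder n (threshold l') (code l').2.1).toPreorder
      (@RelIso.mk _ _ _ _ e fun {a b} => (he a b).symm) a b)
    exact hlt.symm
  · rintro ⟨P, hP⟩
    obtain ⟨l, hpos, hl, ⟨iso⟩⟩ := exists_code hP
    exact ⟨⟨l, hl⟩, Quot.sound ⟨iso.toEquiv, fun a b => iso.map_rel_iff.symm⟩⟩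

theorem statement14 (h : ℕ) :
    (PowerSeries.mk fun n => (fLe h n : ℚ)) = pSeq h * (pSeq (h + 1))⁻¹ := by
  ext n
  rw [PowerSeries.coeff_mk, fLe_eq_card, card_forestCodes, pow_one, pow_zero, mul_one,
    treeSeries, PowerSeries.coeff_succ_X_mul, inv_one_sub_treeSeries_eq]

end Paper
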